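/- Let φ : H₂ → H₂ be a bijection such that for all A, B ∈ H₂: rank(A − B) ≤ 1 if and only if rank(φ(A) − φ(B)) ≤ 1. Then there exist c ∈ {−1, 1}, an invertible 2×2 complex matrix S, and T ∈ H₂ such that either φ(A) = c·S A S* + T for every A ∈ H₂, or φ(A) = c·S Aᵗ S* + T for every A ∈ H₂ (where Aᵗ is the transpose and S* the conjugate transpose). -/

import Mathlib

open Matrix
open scoped ComplexOrder

noncomputable section

/-- The space of `2×2` complex matrices. -/
abbrev Mat2 : Type := Matrix (Fin 2) (Fin 2) ℂ

/-- The group of `2×2` complex unitary matrices. -/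
abbrev U2 : Type := Matrix.unitaryGroup (Fin 2) ℂ

/-- Coherency for matrices: `A ∼ B` iff `rank (A − B) ≤ 1`. -/
def Coherent (A B : Mat2) : Prop := (A - B).rank ≤ 1

/-- Coherency for unitaries: `U ∼ V` iff `rank (U − V) ≤ 1`. -/
def CoherentU (U V : U2) : Prop := ((U : Mat2) - (V : Mat2)).rank ≤ 1

/-- The Cayley transform, as a matrix: `𝔠(A) = (A − iI)(A + iI)⁻¹`. -/
def cayleyMat (A : Mat2) : Mat2 :=
  (A - Complex.I • (1 : Mat2)) * (A + Complex.I • (1 : Mat2))⁻¹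

open Classical in
/-- The Cayley transform, landing in the unitary group.  For every hermitian `A` the matrix
`cayleyMat A` is unitary, so the junk value `1` is never used for the matrices considered here. -/
def cayley (A : Mat2) : U2 :=
  if h : cayleyMat A ∈ Matrix.unitaryGroup (Fin 2) ℂ then ⟨cayleyMat A, h⟩ else 1

/-- An automorphism of `U₂`: a bijection preserving coherency in both directions. -/
def IsAut (Φ : U2 → U2) : Prop :=
  Function.Bijective Φ ∧ ∀ U V : U2, CoherentU U V ↔ CoherentU (Φ U) (Φ V)

/-- A line in `U₂`: a maximal subset all of whose elements are pairwise coherent. -/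
def IsLine (ℓ : Set U2) : Prop :=
  (∀ U ∈ ℓ, ∀ V ∈ ℓ, CoherentU U V) ∧
  ∀ m : Set U2, ℓ ⊆ m → (∀ U ∈ m, ∀ V ∈ m, CoherentU U V) → m = ℓ

/-- The matrix interval `[A, B] = {X : A ≤ X ≤ B}` (in the Loewner order). -/
def matIcc (A B : Mat2) : Set Mat2 := {X | (X - A).PosSemidef ∧ (B - X).PosSemidef}

/-- Rank one projections: `P = P* = P²` of rank one. -/
def IsProj1 (P : Mat2) : Prop := P.IsHermitian ∧ P * P = P ∧ P.rank = 1

/-- The set of `2×2` complex hermitian matrices. -/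
def H2set : Set Mat2 := {A | A.IsHermitian}

theorem Equiv.map_add_sub_ne_zero {V : Type*} [AddCommGroup V] (φ : V ≃ V) (P : V) {v : V}
    (hv : v ≠ 0) : φ (P + v) - φ P ≠ 0 := by
  rw [sub_ne_zero]
  simpa using hv

section LightCone

variable {V : Type*} [AddCommGroup V] [Module ℝ V] {B : V →ₗ[ℝ] V →ₗ[ℝ] ℝ}

/-- The map `φ` preserves, in both directions, the relation that a difference is isotropic. -/
def PreservesLightCones (B : V →ₗ[ℝ] V →ₗ[ℝ] ℝ) (φ : V ≃ V) : Prop :=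
  ∀ x y, B (x - y) (x - y) = 0 ↔ B (φ x - φ y) (φ x - φ y) = 0

/-- Orthogonal isotropic vectors are proportional, as for a Lorentzian form. -/
def IsotropicOrthogonalParallel (B : V →ₗ[ℝ] V →ₗ[ℝ] ℝ) : Prop :=
  ∀ v x, v ≠ 0 → B v v = 0 → B x x = 0 → B v x = 0 → ∃ t : ℝ, x = t • v

/-- Additively, the isotropic vectors not orthogonal to a given isotropic vector generate. -/
def TransverseIsotropicGenerate (B : V →ₗ[ℝ] V →ₗ[ℝ] ℝ) : Prop :=
  ∀ v, v ≠ 0 → B v v = 0 → ∀ G : AddSubgroup V,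
    (∀ w, B w w = 0 → B v w ≠ 0 → w ∈ G) → G = ⊤

theorem isotropic_sub_iff (hs : ∀ x y, B x y = B y x) {u w : V} (hu : B u u = 0)
    (hw : B w w = 0) : B (u - w) (u - w) = 0 ↔ B u w = 0 := by
  have e : B (u - w) (u - w) = -2 * B u w := by
    simp only [map_sub, LinearMap.sub_apply, hu, hw, hs w u]
    ring
  rw [e]
  simp

namespace PreservesLightCones

theorem symm {φ : V ≃ V} (h : PreservesLightCones B φ) : PreservesLightCones B φ.symm := by
  intro x y
  simpa using (h (φ.symm x) (φ.symm y)).symm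

theorem isotropic_sub {φ : V ≃ V} (h : PreservesLightCones B φ) (P : V) {v : V}
    (hv : B v v = 0) : B (φ (P + v) - φ P) (φ (P + v) - φ P) = 0 :=
  (h _ _).1 (by simpa using hv)

/-- Isotropic lines are mapped into isotropic lines. -/
theorem map_line (hs : ∀ x y, B x y = B y x) (hp : IsotropicOrthogonalParallel B)
    {φ : V ≃ V} (h : PreservesLightCones B φ) (P : V) {v : V} (hv0 : v ≠ 0) (hv : B v v = 0)
    (t : ℝ) : ∃ s : ℝ, φ (P + t • v) = φ P + s • (φ (P + v) - φ P) := by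
  have h1 := h.isotropic_sub P hv
  have h2 : B (φ (P + t • v) - φ P) (φ (P + t • v) - φ P) = 0 :=
    h.isotropic_sub P (by simp [hv])
  have h3 : B (φ (P + t • v) - φ (P + v)) (φ (P + t • v) - φ (P + v)) = 0 := by
    refine (h _ _).1 ?_
    have : P + t • v - (P + v) = (t - 1) • v := by module
    simp [this, hv]
  have h4 : B (φ (P + v) - φ P) (φ (P + t • v) - φ P) = 0 := by
    have e : φ (P + t • v) - φ (P + v) = (φ (P + t • v) - φ P) - (φ (P + v) - φ P) := by abel
    rw [e, isotropic_sub_iff hs h2 h1, hs] at h3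
    exact h3
  obtain ⟨s, hs'⟩ := hp _ _ (φ.map_add_sub_ne_zero P hv0) h1 h2 h4
  exact ⟨s, by rw [← hs']; abel⟩

/-- Isotropic lines are mapped onto isotropic lines. -/
theorem map_line_surj (hs : ∀ x y, B x y = B y x) (hp : IsotropicOrthogonalParallel B)
    {φ : V ≃ V} (h : PreservesLightCones B φ) (P : V) {v : V} (hv0 : v ≠ 0) (hv : B v v = 0)
    (s : ℝ) : ∃ t : ℝ, φ (P + t • v) = φ P + s • (φ (P + v) - φ P) := by
  obtain ⟨t, ht⟩ := h.symm.map_line hs hp (φ P) (φ.map_add_sub_ne_zero P hv0)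
    (h.isotropic_sub P hv) s
  refine ⟨t, ?_⟩
  simp only [add_sub_cancel, Equiv.symm_apply_apply, add_sub_cancel_left] at ht
  rw [← ht, Equiv.apply_symm_apply]

/-- Parallel isotropic lines are mapped to parallel lines. -/
theorem map_parallel (hs : ∀ x y, B x y = B y x) (hp : IsotropicOrthogonalParallel B)
    {φ : V ≃ V} (h : PreservesLightCones B φ) (P Q : V) {v : V} (hv0 : v ≠ 0)
    (hv : B v v = 0) : ∃ a : ℝ, φ (Q + v) - φ Q = a • (φ (P + v) - φ P) := by
  have hP0 : φ (P + v) - φ P ≠ 0 := φ.map_add_sub_ne_zero P hv0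
  have hP := h.isotropic_sub P hv
  have hQ := h.isotropic_sub Q hv
  have lineP := h.map_line hs hp P hv0 hv
  have lineP' := h.map_line_surj hs hp P hv0 hv
  have lineQ' := h.map_line_surj hs hp Q hv0 hv
  generalize hv' : φ (P + v) - φ P = v' at *
  generalize hw' : φ (Q + v) - φ Q = w' at *
  by_contra hcon
  have hne : B v' w' ≠ 0 := fun h0 => hcon (hp _ _ hP0 hP hQ h0)
  -- the quadratic form along an isotropic line
  have expand : ∀ (x u : V) (t : ℝ), B u u = 0 →
      B (x - t • u) (x - t • u) = B x x - 2 * t * B u x := by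
    intro x u t hu
    simp only [map_sub, map_smul, LinearMap.sub_apply, LinearMap.smul_apply, smul_eq_mul, hu,
      hs x u]
    ring
  by_cases hPQ : B v (Q - P) = 0
  · by_cases hN : B (Q - P) (Q - P) = 0
    · obtain ⟨t, ht⟩ := hp _ _ hv0 hv hN hPQ
      obtain ⟨s₁, h₁⟩ := lineP t
      obtain ⟨s₂, h₂⟩ := lineP (t + 1)
      have e1 : P + t • v = Q := by rw [← ht]; abel
      have e2 : P + (t + 1) • v = Q + v := by rw [← e1]; module
      rw [e1] at h₁
      rw [e2] at h₂
      exact hcon ⟨s₂ - s₁, by rw [← hw', h₁, h₂]; module⟩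
    · obtain ⟨s, hsv⟩ : ∃ s : ℝ, B v' (φ Q + s • w' - φ P) ≠ 0 := by
        refine ⟨(1 - B v' (φ Q - φ P)) / B v' w', ?_⟩
        rw [add_sub_right_comm, map_add, map_smul, smul_eq_mul, div_mul_cancel₀ _ hne]
        simp
      obtain ⟨t', ht'⟩ := lineQ' s
      obtain ⟨t, ht⟩ := lineP' (B (φ Q + s • w' - φ P) (φ Q + s • w' - φ P) /
        (2 * B v' (φ Q + s • w' - φ P)))
      have h0 := expand (φ Q + s • w' - φ P) v' (B (φ Q + s • w' - φ P) (φ Q + s • w' - φ P) /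
        (2 * B v' (φ Q + s • w' - φ P))) hP
      rw [sub_sub, ← ht, ← ht'] at h0
      have h1 := (h (Q + t' • v) (P + t • v)).2 (by rw [h0, ht']; field_simp; ring)
      have e : Q + t' • v - (P + t • v) = (Q - P) - (t - t') • v := by module
      rw [e, expand _ _ _ hv, hPQ] at h1
      exact hN (by simpa using h1)
  · obtain ⟨s, hsv⟩ : ∃ s : ℝ, B v' (φ Q + s • w' - φ P) = 0 := by
      refine ⟨(- B v' (φ Q - φ P)) / B v' w', ?_⟩
      rw [add_sub_right_comm, map_add, map_smul, smul_eq_mul, div_mul_cancel₀ _ hne]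
      simp
    obtain ⟨t', ht'⟩ := lineQ' s
    set t := B (Q + t' • v - P) (Q + t' • v - P) / (2 * B v (Q - P)) with htdef
    have hv2 : B v (Q + t' • v - P) = B v (Q - P) := by
      rw [add_sub_right_comm, map_add, map_smul, hv]; simp
    have h0 := expand (Q + t' • v - P) v t hv
    rw [hv2, sub_sub] at h0
    have h1 := (h (Q + t' • v) (P + t • v)).1 (by rw [h0, htdef]; field_simp; ring)
    obtain ⟨s₂, hs₂⟩ := lineP t
    rw [ht', hs₂, ← sub_sub, expand _ _ _ hP, hsv] at h1
    obtain ⟨r, hr⟩ := hp _ _ hP0 hP (by simpa using h1) hsv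
    obtain ⟨t₂, ht₂⟩ := lineP' r
    have e : φ (Q + t' • v) = φ (P + t₂ • v) := by rw [ht', ht₂, ← hr]; abel
    have e' : Q - P = (t₂ - t') • v := by
      have := φ.injective e
      rw [sub_smul, sub_eq_sub_iff_add_eq_add, this, add_comm]
    exact hPQ (by rw [e', map_smul, hv, smul_zero])

/-- Differences in transverse isotropic directions satisfy the parallelogram law. -/
theorem map_parallelogram (hs : ∀ x y, B x y = B y x) (hp : IsotropicOrthogonalParallel B)
    {φ : V ≃ V} (h : PreservesLightCones B φ) (P : V) {v w : V} (hv : B v v = 0)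
    (hw : B w w = 0) (hvw : B v w ≠ 0) :
    φ (P + w + v) - φ (P + w) = φ (P + v) - φ P := by
  have hv0 : v ≠ 0 := by rintro rfl; simp at hvw
  have hw0 : w ≠ 0 := by rintro rfl; simp at hvw
  obtain ⟨a, ha⟩ := h.map_parallel hs hp P (P + w) hv0 hv
  obtain ⟨b, hb⟩ := h.map_parallel hs hp P (P + v) hw0 hw
  have hPv := h.isotropic_sub P hv
  have hPw := h.isotropic_sub P hw
  have hcross : B (φ (P + v) - φ P) (φ (P + w) - φ P) ≠ 0 := by
    intro h0
    have h1 := (h (P + v) (P + w)).2 (by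
      have e : φ (P + v) - φ (P + w) = (φ (P + v) - φ P) - (φ (P + w) - φ P) := by abel
      rwa [e, isotropic_sub_iff hs hPv hPw])
    rw [add_sub_add_left_eq_sub, isotropic_sub_iff hs hv hw] at h1
    exact hvw h1
  have key : (a - 1) • (φ (P + v) - φ P) = (b - 1) • (φ (P + w) - φ P) := by
    rw [sub_smul, sub_smul, ← ha, ← hb, one_smul, one_smul, add_right_comm]
    abel
  have h2 := congrArg (fun x => B x (φ (P + w) - φ P)) key
  simp only [map_smul, LinearMap.smul_apply, hPw, smul_eq_mul, mul_zero, mul_eq_zero] at h2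
  have : a = 1 := by linarith [h2.resolve_right hcross]
  rw [ha, this, one_smul]

/-- An Alexandrov-type theorem: bijections preserving light cones and fixing `0` are additive. -/
theorem map_add (hs : ∀ x y, B x y = B y x) (hp : IsotropicOrthogonalParallel B)
    (hg : TransverseIsotropicGenerate B) {φ : V ≃ V} (h : PreservesLightCones B φ)
    (h0 : φ 0 = 0) (hex : ∃ v, v ≠ 0 ∧ B v v = 0) (x y : V) : φ (x + y) = φ x + φ y := by
  have translate : ∀ v, B v v = 0 → ∀ P, φ (P + v) = φ P + φ v := by
    intro v hv P
    rcases eq_or_ne v 0 with rfl | hv0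
    · simp [h0]
    let G : AddSubgroup V :=
      { carrier := {u | ∀ P, φ (P + u + v) - φ (P + u) = φ (P + v) - φ P}
        zero_mem' := by intro P; simp
        add_mem' := by
          intro a b ha hb P
          rw [← add_assoc, hb, ha]
        neg_mem' := by
          intro a ha P
          have := ha (P + -a)
          rw [neg_add_cancel_right] at this
          exact this.symm }
    have hG : G = ⊤ := hg v hv0 hv G fun w hw hvw P => h.map_parallelogram hs hp P hv hw hvw
    have hmem : P ∈ G := by rw [hG]; trivial
    have h1 : φ (0 + P + v) - φ (0 + P) = φ (0 + v) - φ 0 := hmem 0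
    rw [zero_add, zero_add, h0, sub_zero] at h1
    rw [← h1]; abel
  obtain ⟨v, hv0, hv⟩ := hex
  let G : AddSubgroup V :=
    { carrier := {u | ∀ P, φ (P + u) = φ P + φ u}
      zero_mem' := by intro P; simp [h0]
      add_mem' := by
        intro a b ha hb P
        rw [← add_assoc, hb, ha, hb a, add_assoc]
      neg_mem' := by
        intro a ha P
        have h1 := ha (P + -a)
        have h2 := ha (-a)
        rw [neg_add_cancel_right] at h1
        rw [neg_add_cancel, h0] at h2
        rw [h1, add_assoc, add_comm (φ a), ← h2, add_zero] }
  have hG : G = ⊤ := hg v hv0 hv G fun w hw _ => translate w hw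
  have hmem : y ∈ G := by rw [hG]; trivial
  exact hmem x

end PreservesLightCones

end LightCone

section Minkowski

/-- Coordinates `(a, b, z)` of the hermitian matrix with diagonal `a, b` and corner entry `z`. -/
abbrev HermCoord : Type := ℝ × ℝ × ℂ

/-- The polarization of twice the determinant form `(a, b, z) ↦ a * b - ‖z‖ ^ 2`. -/
def detForm : HermCoord →ₗ[ℝ] HermCoord →ₗ[ℝ] ℝ :=
  LinearMap.mk₂ ℝ (fun x y => x.1 * y.2.1 + x.2.1 * y.1
      - 2 * (x.2.2.re * y.2.2.re + x.2.2.im * y.2.2.im))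
    (by intros; simp; ring) (by intros; simp; ring) (by intros; simp; ring)
    (by intros; simp; ring)

theorem detForm_apply (x y : HermCoord) : detForm x y = x.1 * y.2.1 + x.2.1 * y.1
    - 2 * (x.2.2.re * y.2.2.re + x.2.2.im * y.2.2.im) := rfl

theorem detForm_self_eq_zero_iff (a b : ℝ) (z : ℂ) :
    detForm (a, b, z) (a, b, z) = 0 ↔ a * b = ‖z‖ ^ 2 := by
  rw [← Complex.normSq_eq_norm_sq, Complex.normSq_apply, detForm_apply]
  constructor <;> intro h <;> simp only at * <;> linarith

theorem detForm_comm (x y : HermCoord) : detForm x y = detForm y x := by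
  simp only [detForm_apply]; ring

theorem detForm_isotropicOrthogonalParallel : IsotropicOrthogonalParallel detForm := by
  rintro ⟨a, b, z, w⟩ ⟨c, d, y, x⟩ hv0 hv hx hvx
  simp only [detForm_apply] at hv hx hvx
  rcases eq_or_ne a 0 with rfl | ha
  · have hz : z = 0 := by nlinarith [sq_nonneg z, sq_nonneg w]
    have hw : w = 0 := by nlinarith [sq_nonneg z, sq_nonneg w]
    subst hz hw
    have hb : b ≠ 0 := by rintro rfl; exact hv0 rfl
    have hc : c = 0 := by
      have : b * c = 0 := by linarith
      exact (mul_eq_zero.1 this).resolve_left hb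
    subst hc
    have hy : y = 0 := by nlinarith [sq_nonneg y, sq_nonneg x]
    have hx' : x = 0 := by nlinarith [sq_nonneg y, sq_nonneg x]
    subst hy hx'
    refine ⟨d / b, Prod.ext ?_ (Prod.ext ?_ (Complex.ext ?_ ?_))⟩ <;> simp [hb]
  · have key : (a * y - c * z) ^ 2 + (a * x - c * w) ^ 2 = 0 := by
      linear_combination a * c * hvx - (a ^ 2 / 2) * hx - (c ^ 2 / 2) * hv
    have h1 : a * y - c * z = 0 := by
      nlinarith [sq_nonneg (a * y - c * z), sq_nonneg (a * x - c * w)]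
    have h2 : a * x - c * w = 0 := by
      nlinarith [sq_nonneg (a * y - c * z), sq_nonneg (a * x - c * w)]
    have h3 : a * (a * d - b * c) = 0 := by
      linear_combination a * hvx + 2 * z * h1 + 2 * w * h2 - c * hv
    have h4 := (mul_eq_zero.1 h3).resolve_left ha
    refine ⟨c / a, Prod.ext ?_ (Prod.ext ?_ (Complex.ext ?_ ?_))⟩
    · simp [ha]
    · simp; field_simp; linarith
    · simp; field_simp; linarith
    · simp; field_simp; linarith

theorem detForm_transverseIsotropicGenerate : TransverseIsotropicGenerate detForm := by
  rintro ⟨a, b, z⟩ hv0 hv G hG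
  have reduce : (∀ t : ℝ, ((t, 0, 0) : HermCoord) ∈ G) → (∀ t : ℝ, ((0, t, 0) : HermCoord) ∈ G) →
      (∀ t : ℝ, ((0, 0, (t : ℂ)) : HermCoord) ∈ G) →
      (∀ t : ℝ, ((0, 0, t * Complex.I) : HermCoord) ∈ G) → G = ⊤ := by
    intro h1 h2 h3 h4
    refine (AddSubgroup.eq_top_iff' G).2 ?_
    rintro ⟨c, d, y⟩
    convert G.add_mem (G.add_mem (h1 c) (h2 d)) (G.add_mem (h3 y.re) (h4 y.im)) using 1
    ext <;> simp
  rw [detForm_self_eq_zero_iff] at hv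
  -- scaled rank one elements with nonzero first coordinate
  have rankOne : ∀ (t : ℝ) (y : ℂ), detForm (a, b, z) (1, ‖y‖ ^ 2, y) ≠ 0 →
      ((t, t * ‖y‖ ^ 2, t * y) : HermCoord) ∈ G := by
    intro t y hy
    rcases eq_or_ne t 0 with rfl | ht
    · simp [← Prod.zero_eq_mk]
    · refine hG _ ?_ ?_
      · rw [detForm_self_eq_zero_iff]
        simp [mul_pow]; ring
      · have : ((t, t * ‖y‖ ^ 2, t * y) : HermCoord) = t • (1, ‖y‖ ^ 2, y) := by
          ext <;> simp
        rw [this, map_smul]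
        exact mul_ne_zero ht hy
  rcases eq_or_ne a 0 with rfl | ha
  · have hz : z = 0 := by simpa using hv.symm
    subst hz
    have hb : b ≠ 0 := by rintro rfl; exact hv0 rfl
    have rankOne' : ∀ (t : ℝ) (y : ℂ), ((t, t * ‖y‖ ^ 2, t * y) : HermCoord) ∈ G :=
      fun t y => rankOne t y (by simp [detForm_apply, hb])
    have h1 : ∀ t : ℝ, ((t, 0, 0) : HermCoord) ∈ G := fun t => by simpa using rankOne' t 0
    have h2 : ∀ t : ℝ, ((0, t, 0) : HermCoord) ∈ G := by
      intro t
      convert G.sub_mem (G.add_mem (rankOne' (t / 2) 1) (rankOne' (t / 2) (-1))) (h1 t) using 1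
      ext <;> simp
    refine reduce h1 h2 (fun t => ?_) (fun t => ?_)
    · convert G.sub_mem (G.sub_mem (rankOne' t 1) (h1 t)) (h2 t) using 1
      ext <;> simp
    · convert G.sub_mem (G.sub_mem (rankOne' t Complex.I) (h1 t)) (h2 t) using 1
      ext <;> simp
  · have h2 : ∀ t : ℝ, ((0, t, 0) : HermCoord) ∈ G := by
      intro t
      rcases eq_or_ne t 0 with rfl | ht
      · exact G.zero_mem
      · exact hG _ (by simp [detForm_apply]) (by simp [detForm_apply, ha, ht])
    have shifted : ∀ (t : ℝ) (u : ℂ), u ≠ 0 → ((t, 0, t * (z / a + u)) : HermCoord) ∈ G := by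
      intro t u hu
      have hne : detForm (a, b, z) (1, ‖z / a + u‖ ^ 2, z / a + u) ≠ 0 := by
        have e : detForm (a, b, z) (1, ‖z / a + u‖ ^ 2, z / a + u) = a * ‖u‖ ^ 2 := by
          have hb : b = (z.re ^ 2 + z.im ^ 2) / a := by
            rw [← Complex.normSq_eq_norm_sq, Complex.normSq_apply] at hv
            field_simp; linarith
          simp only [detForm_apply, ← Complex.normSq_eq_norm_sq, Complex.normSq_apply,
            Complex.add_re, Complex.add_im, Complex.div_ofReal_re, Complex.div_ofReal_im, hb]
          field_simp
          ring
        rw [e]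
        simp [ha, hu]
      convert G.sub_mem (rankOne t _ hne) (h2 (t * ‖z / a + u‖ ^ 2)) using 1
      ext <;> simp
    have h3 : ∀ t : ℝ, ((0, 0, (t : ℂ)) : HermCoord) ∈ G := by
      intro t
      convert G.sub_mem (shifted t 2 two_ne_zero) (shifted t 1 one_ne_zero) using 1
      ext <;> simp
      ring
    have h4 : ∀ t : ℝ, ((0, 0, t * Complex.I) : HermCoord) ∈ G := by
      intro t
      convert G.sub_mem (shifted t (2 * Complex.I) (by simp)) (shifted t Complex.I (by simp)) using 1
      ext <;> simp
      ring
    refine reduce (fun t => ?_) h2 h3 h4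
    convert G.sub_mem (G.sub_mem (shifted t 1 one_ne_zero) (h3 (t * (z / a + 1).re)))
      (h4 (t * (z / a + 1).im)) using 1
    refine Prod.ext ?_ (Prod.ext ?_ (Complex.ext ?_ ?_)) <;> simp

end Minkowski

section Normalized

/-- An additive map `f` with `f a * f b = f (a * b) * f 1` whenever `0 ≤ a * b` is linear. -/
theorem AddMonoidHom.eq_mul_of_map_mul_of_nonneg (f : ℝ →+ ℝ) (h1 : f 1 ≠ 0)
    (hf : ∀ a b, 0 ≤ a * b → f a * f b = f (a * b) * f 1) (a : ℝ) : f a = f 1 * a := by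
  have hmul : ∀ a b, f a * f b = f (a * b) * f 1 := by
    intro a b
    rcases le_total 0 (a * b) with h | h
    · exact hf a b h
    · have := hf a (-b) (by linarith [mul_neg a b])
      simp only [map_neg, mul_neg, neg_mul, neg_inj] at this
      exact this
  let F : ℝ →+* ℝ := RingHom.mk'
    { toFun := fun a => f a / f 1
      map_one' := div_self h1
      map_mul' := fun a b => by
        rw [div_mul_div_comm, hmul, mul_div_mul_right _ _ h1] }
    (fun a b => by simp [add_div])
  have hF : F a = a := by rw [Subsingleton.elim F (RingHom.id ℝ), RingHom.id_apply]
  have hF' : f a / f 1 = a := hF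
  rw [div_eq_iff h1] at hF'
  rw [mul_comm]; exact hF'

/-- Additive maps of `ℂ` scaling the norm are complex linear or antilinear. -/
theorem AddMonoidHom.eq_mul_or_eq_mul_conj (h : ℂ →+ ℂ) {k : ℝ} (hk : 0 < k)
    (hh : ∀ z, ‖h z‖ = k * ‖z‖) :
    ∃ l : ℂ, ‖l‖ = k ∧ ((∀ z, h z = l * z) ∨ ∀ z, h z = l * (starRingEnd ℂ) z) := by
  have hcont : Continuous h := AddMonoidHomClass.continuous_of_bound h k fun z => (hh z).le
  let L : ℂ →ₗ[ℝ] ℂ := k⁻¹ • (h.toRealLinearMap hcont : ℂ →ₗ[ℝ] ℂ)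
  have hL : ∀ z, h z = k * L z := by
    intro z
    have : L z = (k⁻¹ : ℝ) • h z := rfl
    rw [this, Complex.real_smul, ← mul_assoc, ← Complex.ofReal_mul, mul_inv_cancel₀ hk.ne']
    simp
  let I : ℂ →ₗᵢ[ℝ] ℂ := ⟨L, fun z => by
    have h1 := hh z
    rw [hL z, norm_mul, Complex.norm_real, Real.norm_eq_abs, abs_of_pos hk] at h1
    exact mul_left_cancel₀ hk.ne' h1⟩
  obtain ⟨u, hu⟩ := linear_isometry_complex (I.toLinearIsometryEquiv rfl)
  refine ⟨k * u, by simp [Circle.norm_coe, abs_of_pos hk], ?_⟩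
  have hI : ∀ z, h z = k * (I.toLinearIsometryEquiv rfl) z := hL
  rcases hu with hu | hu
  · left; intro z
    rw [hI, hu, rotation_apply, mul_assoc]
  · right; intro z
    rw [hI, hu, LinearIsometryEquiv.trans_apply, rotation_apply, Complex.conjLIE_apply, mul_assoc]

theorem PreservesLightCones.normal_form {ψ : HermCoord ≃ HermCoord}
    (hψ : PreservesLightCones detForm ψ) (h0 : ψ 0 = 0) {p q : ℝ} (h1 : ψ (1, 0, 0) = (p, 0, 0))
    (h2 : ψ (0, 1, 0) = (0, q, 0)) : ∃ l : ℂ, l ≠ 0 ∧ p * q = ‖l‖ ^ 2 ∧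
      ((∀ a b z, ψ (a, b, z) = (p * a, q * b, l * z)) ∨
        ∀ a b z, ψ (a, b, z) = (p * a, q * b, l * (starRingEnd ℂ) z)) := by
  have line := fun {v : HermCoord} => hψ.map_line detForm_comm
    detForm_isotropicOrthogonalParallel 0 (v := v)
  have line' := fun {v : HermCoord} => hψ.map_line_surj detForm_comm
    detForm_isotropicOrthogonalParallel 0 (v := v)
  simp only [zero_add, h0, sub_zero] at line line'
  have e1 : ((1, 0, 0) : HermCoord) ≠ 0 := by simp
  have e2 : ((0, 1, 0) : HermCoord) ≠ 0 := by simp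
  have n1 : detForm (1, 0, 0) (1, 0, 0) = 0 := by simp [detForm_apply]
  have n2 : detForm (0, 1, 0) (0, 1, 0) = 0 := by simp [detForm_apply]
  let Ψ : HermCoord →+ HermCoord := AddMonoidHom.mk' ψ (hψ.map_add detForm_comm
    detForm_isotropicOrthogonalParallel detForm_transverseIsotropicGenerate h0 ⟨_, e1, n1⟩)
  have hp : p ≠ 0 := by
    rintro rfl
    exact e1 (ψ.injective (h1.trans h0.symm))
  have hq : q ≠ 0 := by
    rintro rfl
    exact e2 (ψ.injective (h2.trans h0.symm))
  let f : ℝ →+ ℝ := (AddMonoidHom.fst ℝ (ℝ × ℂ)).comp (Ψ.comp (AddMonoidHom.inl ℝ (ℝ × ℂ)))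
  let g : ℝ →+ ℝ := (AddMonoidHom.fst ℝ ℂ).comp ((AddMonoidHom.snd ℝ (ℝ × ℂ)).comp
    (Ψ.comp ((AddMonoidHom.inr ℝ (ℝ × ℂ)).comp (AddMonoidHom.inl ℝ ℂ))))
  let h : ℂ →+ ℂ := (AddMonoidHom.snd ℝ ℂ).comp ((AddMonoidHom.snd ℝ (ℝ × ℂ)).comp
    (Ψ.comp ((AddMonoidHom.inr ℝ (ℝ × ℂ)).comp (AddMonoidHom.inr ℝ ℂ))))
  have hf : ∀ t, ψ (t, 0, 0) = (f t, 0, 0) := by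
    intro t
    obtain ⟨s, hs⟩ := line e1 n1 t
    rw [h1] at hs
    have hs' : ψ (t, 0, 0) = (s * p, 0, 0) := by simpa using hs
    have : f t = (ψ (t, 0, 0)).1 := rfl
    rw [this, hs']
  have hg : ∀ t, ψ (0, t, 0) = (0, g t, 0) := by
    intro t
    obtain ⟨s, hs⟩ := line e2 n2 t
    rw [h2] at hs
    have hs' : ψ (0, t, 0) = (0, s * q, 0) := by simpa using hs
    have : g t = (ψ (0, t, 0)).2.1 := rfl
    rw [this, hs']
  have hh : ∀ z, ψ (0, 0, z) = (0, 0, h z) := by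
    intro z
    have hz : h z = (ψ (0, 0, z)).2.2 := rfl
    rw [hz]
    rcases eq_or_ne z 0 with rfl | hz0
    · have : ψ (0, 0, 0) = 0 := h0
      rw [this]; rfl
    generalize hx : ψ (0, 0, z) = x
    obtain ⟨a, b, y⟩ := x
    have hb : b = 0 := by
      by_contra hb
      obtain ⟨t, ht⟩ := line' e1 n1 ((a - ‖y‖ ^ 2 / b) / p)
      have h3 := (hψ (0, 0, z) (t • (1, 0, 0))).2 (by
        rw [ht, h1, hx]
        simp only [Prod.smul_mk, smul_eq_mul, mul_zero, smul_zero, Prod.mk_sub_mk, sub_zero]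
        rw [detForm_self_eq_zero_iff]
        field_simp; ring)
      simp only [Prod.smul_mk, smul_eq_mul, mul_zero, smul_zero, Prod.mk_sub_mk, sub_zero] at h3
      rw [detForm_self_eq_zero_iff] at h3
      exact hz0 (by simpa using h3.symm)
    have ha : a = 0 := by
      by_contra ha
      obtain ⟨t, ht⟩ := line' e2 n2 ((b - ‖y‖ ^ 2 / a) / q)
      have h3 := (hψ (0, 0, z) (t • (0, 1, 0))).2 (by
        rw [ht, h2, hx]
        simp only [Prod.smul_mk, smul_eq_mul, mul_zero, smul_zero, Prod.mk_sub_mk, sub_zero]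
        rw [detForm_self_eq_zero_iff]
        field_simp; ring)
      simp only [Prod.smul_mk, smul_eq_mul, mul_zero, smul_zero, Prod.mk_sub_mk, sub_zero] at h3
      rw [detForm_self_eq_zero_iff] at h3
      exact hz0 (by simpa using h3.symm)
    rw [ha, hb]
  have hsplit : ∀ a b z, ψ (a, b, z) = (f a, g b, h z) := by
    intro a b z
    have e : ((a, b, z) : HermCoord) = (a, 0, 0) + ((0, b, 0) + (0, 0, z)) := by simp
    have e' : ψ (a, b, z) = ψ (a, 0, 0) + (ψ (0, b, 0) + ψ (0, 0, z)) := by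
      rw [e]
      exact (Ψ.map_add _ _).trans (congrArg _ (Ψ.map_add _ _))
    rw [e', hf, hg, hh]; simp
  have hf1 : f 1 = p := congrArg Prod.fst h1
  have hg1 : g 1 = q := congrArg (fun x => x.2.1) h2
  have hnull : ∀ a b z, a * b = ‖z‖ ^ 2 → f a * g b = ‖h z‖ ^ 2 := by
    intro a b z hab
    rw [← detForm_self_eq_zero_iff, ← hsplit]
    rw [← detForm_self_eq_zero_iff] at hab
    simpa [h0] using (hψ (a, b, z) 0).1 (by simpa using hab)
  have hfg : ∀ a b, 0 ≤ a * b → f a * g b = f (a * b) * g 1 := by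
    intro a b hab
    have hn : ‖((√(a * b) : ℝ) : ℂ)‖ ^ 2 = a * b := by
      rw [Complex.norm_real, Real.norm_eq_abs, sq_abs, Real.sq_sqrt hab]
    rw [hnull a b _ hn.symm, hnull (a * b) 1 _ ((mul_one _).trans hn.symm)]
  have hgf : ∀ a, p * g a = q * f a := by
    have pos : ∀ a, 0 ≤ a → p * g a = q * f a := by
      intro a ha
      have := hfg 1 a (by simpa using ha)
      rw [one_mul, hf1, hg1] at this
      rw [this, mul_comm]
    intro a
    rcases le_total 0 a with ha | ha
    · exact pos a ha
    · have := pos (-a) (by linarith)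
      simpa using this
  have hfl : ∀ a, f a = p * a := by
    rw [← hf1]
    refine f.eq_mul_of_map_mul_of_nonneg (by rwa [hf1]) fun a b hab => ?_
    have h3 := hfg a b hab
    rw [hg1] at h3
    rw [hf1]
    refine mul_left_cancel₀ hq ?_
    linear_combination p * h3 - f a * hgf b
  have hgl : ∀ b, g b = q * b := by
    intro b
    refine mul_left_cancel₀ hp ?_
    rw [hgf, hfl]; ring
  have hhn : ∀ z, p * q * ‖z‖ ^ 2 = ‖h z‖ ^ 2 := by
    intro z
    have := hnull (‖z‖ ^ 2) 1 z (mul_one _)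
    rw [hg1, hfl] at this
    linarith
  have hpq : 0 < p * q := by
    refine lt_of_le_of_ne ?_ (mul_ne_zero hp hq).symm
    have := hhn 1
    simp only [norm_one, one_pow, mul_one] at this
    rw [this]; positivity
  obtain ⟨l, hl, hl'⟩ := h.eq_mul_or_eq_mul_conj (Real.sqrt_pos.2 hpq) (fun z => by
    rw [← sq_eq_sq₀ (norm_nonneg _) (by positivity), mul_pow, Real.sq_sqrt hpq.le, hhn])
  refine ⟨l, ?_, by rw [hl, Real.sq_sqrt hpq.le], ?_⟩
  · rw [← norm_pos_iff, hl]; exact Real.sqrt_pos.2 hpq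
  · simp only [hsplit, hfl, hgl, Prod.mk.injEq, true_and]
    exact hl'.imp (fun h a b z => h z) (fun h a b z => h z)

end Normalized

section Hermitian

/-- A square matrix of size two has rank at most one iff it is singular. -/
theorem Matrix.rank_le_one_iff_det_eq_zero {K : Type*} [Field K] (A : Matrix (Fin 2) (Fin 2) K) :
    A.rank ≤ 1 ↔ A.det = 0 := by
  constructor
  · intro h
    by_contra hdet
    have := Matrix.rank_of_isUnit A ((Matrix.isUnit_iff_isUnit_det A).2 (isUnit_iff_ne_zero.2 hdet))
    rw [this, Fintype.card_fin] at h
    omega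
  · intro h
    obtain ⟨v, hv0, hv⟩ := Matrix.exists_mulVec_eq_zero_iff.2 h
    have hker : 0 < Module.finrank K (LinearMap.ker A.mulVecLin) := by
      rw [Module.finrank_pos_iff]
      exact ⟨⟨⟨v, by simpa using hv⟩, 0, fun h => hv0 (congrArg Subtype.val h)⟩⟩
    have hrn := LinearMap.finrank_range_add_finrank_ker A.mulVecLin
    rw [Module.finrank_fin_fun] at hrn
    rw [Matrix.rank]
    omega

/-- The hermitian matrix with given coordinates. -/
def toHerm (x : HermCoord) : Mat2 := !![(x.1 : ℂ), x.2.2; (starRingEnd ℂ) x.2.2, (x.2.1 : ℂ)]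

theorem toHerm_mem (x : HermCoord) : toHerm x ∈ H2set := by
  change (toHerm x)ᴴ = toHerm x
  ext i j
  fin_cases i <;> fin_cases j <;> simp [toHerm, Matrix.conjTranspose_apply]

theorem toHerm_sub (x y : HermCoord) : toHerm x - toHerm y = toHerm (x - y) := by
  ext i j
  fin_cases i <;> fin_cases j <;> simp [toHerm]

/-- The coordinate description of `H2set`. -/
def hermEquiv : HermCoord ≃ H2set where
  toFun x := ⟨toHerm x, toHerm_mem x⟩
  invFun A := ((A.1 0 0).re, (A.1 1 1).re, A.1 0 1)
  left_inv x := by simp [toHerm]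
  right_inv A := by
    have hA : A.1.IsHermitian := A.2
    ext i j
    fin_cases i <;> fin_cases j
    · exact hA.coe_re_apply_self 0
    · rfl
    · exact hA.apply 1 0
    · exact hA.coe_re_apply_self 1

theorem toHerm_det (x : HermCoord) : (toHerm x).det = 0 ↔ detForm x x = 0 := by
  obtain ⟨a, b, z⟩ := x
  rw [detForm_self_eq_zero_iff, toHerm, Matrix.det_fin_two_of, Complex.mul_conj, sub_eq_zero,
    Complex.normSq_eq_norm_sq]
  norm_cast

theorem exists_coord_equiv {φ : Mat2 → Mat2} (hbij : Set.BijOn φ H2set H2set)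
    (h : ∀ A ∈ H2set, ∀ B ∈ H2set, ((A - B).det = 0 ↔ (φ A - φ B).det = 0)) :
    ∃ ψ : HermCoord ≃ HermCoord, PreservesLightCones detForm ψ ∧
      ∀ x, φ (toHerm x) = toHerm (ψ x) := by
  have key : ∀ x, φ (toHerm x) =
      toHerm ((hermEquiv.trans ((Set.BijOn.equiv φ hbij).trans hermEquiv.symm)) x) := by
    intro x
    have : hermEquiv (hermEquiv.symm (Set.BijOn.equiv φ hbij (hermEquiv x))) =
      Set.BijOn.equiv φ hbij (hermEquiv x) := Equiv.apply_symm_apply _ _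
    exact (congrArg Subtype.val this).symm
  refine ⟨_, fun x y => ?_, key⟩
  have := h _ (toHerm_mem x) _ (toHerm_mem y)
  rwa [key, key, toHerm_sub, toHerm_sub, toHerm_det, toHerm_det] at this

/-- The classification when `0` is fixed and the diagonal matrix units are fixed up to scaling. -/
theorem coherency_preserver_normal_form {φ : Mat2 → Mat2} (hbij : Set.BijOn φ H2set H2set)
    (h : ∀ A ∈ H2set, ∀ B ∈ H2set, ((A - B).det = 0 ↔ (φ A - φ B).det = 0)) {p q : ℝ}
    (h0 : φ (toHerm 0) = toHerm 0) (h1 : φ (toHerm (1, 0, 0)) = toHerm (p, 0, 0))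
    (h2 : φ (toHerm (0, 1, 0)) = toHerm (0, q, 0)) :
    ∃ (c : ℝ) (S : Mat2), (c = 1 ∨ c = -1) ∧ IsUnit S ∧
      ((∀ A ∈ H2set, φ A = c • (S * A * Sᴴ)) ∨ (∀ A ∈ H2set, φ A = c • (S * Aᵀ * Sᴴ))) := by
  obtain ⟨ψ, hψ, hφ⟩ := exists_coord_equiv hbij h
  have hinj : Function.Injective toHerm := fun x y hxy =>
    hermEquiv.injective (Subtype.ext hxy)
  rw [hφ] at h0 h1 h2
  obtain ⟨l, hl0, hpq, hform⟩ := hψ.normal_form (hinj h0) (hinj h1) (hinj h2)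
  have hlpos : 0 < p * q := by rw [hpq]; positivity
  have hp : p ≠ 0 := left_ne_zero_of_mul hlpos.ne'
  have hsurj : ∀ A ∈ H2set, ∃ a b z, A = toHerm (a, b, z) := fun A hA =>
    ⟨_, _, _, (congrArg Subtype.val (hermEquiv.apply_symm_apply ⟨A, hA⟩)).symm⟩
  -- `S = diag(√|p|, conj l / (c √|p|))` where `c` is the sign of `p`
  obtain ⟨c, hc, hcp⟩ : ∃ c : ℝ, (c = 1 ∨ c = -1) ∧ 0 < c * p := by
    rcases lt_or_gt_of_ne hp with hneg | hpos
    · exact ⟨-1, Or.inr rfl, by linarith⟩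
    · exact ⟨1, Or.inl rfl, by linarith⟩
  have hcc : c * c = 1 := by rcases hc with rfl | rfl <;> norm_num
  set s : ℝ := √(c * p)
  have hs0 : 0 < s := Real.sqrt_pos.2 hcp
  have hss : s * s = c * p := Real.mul_self_sqrt hcp.le
  have hccC : (c : ℂ) * c = 1 := by exact_mod_cast hcc
  have hssC : (s : ℂ) * s = c * p := by exact_mod_cast hss
  have hs0C : (s : ℂ) ≠ 0 := by exact_mod_cast hs0.ne'
  have hllC : (starRingEnd ℂ) l * l = p * q := by
    rw [mul_comm, Complex.mul_conj, Complex.normSq_eq_norm_sq, ← hpq]; push_cast; rfl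
  have entry00 : ∀ a : ℂ, (c : ℂ) * (s * a * s) = p * a := fun a => by
    linear_combination (c * a) * hssC + p * a * hccC
  have entry01 : ∀ z : ℂ, (c : ℂ) * (s * z * (c * l / s)) = l * z := fun z => by
    field_simp
    linear_combination z * hccC
  have entry10 : ∀ z : ℂ, (c : ℂ) * (c * (starRingEnd ℂ) l / s * z * s)
      = (starRingEnd ℂ) l * z := fun z => by
    field_simp
    linear_combination (z * (starRingEnd ℂ) l) * hccC
  have entry11 : ∀ b : ℂ, (c : ℂ) * (c * (starRingEnd ℂ) l / s * b * (c * l / s)) = q * b :=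
    fun b => by
      field_simp
      linear_combination (c ^ 3 * b) * hllC - q * b * hssC + (q * p * b * c) * hccC
  refine ⟨c, !![(s : ℂ), 0; 0, c * (starRingEnd ℂ) l / s], hc, ?_, ?_⟩
  · rw [Matrix.isUnit_iff_isUnit_det, Matrix.det_fin_two_of, isUnit_iff_ne_zero]
    have hc0 : (c : ℂ) ≠ 0 := left_ne_zero_of_mul (by rw [hccC]; exact one_ne_zero)
    simp [hs0C, hl0, hc0]
  · refine hform.imp (fun hform A hA => ?_) (fun hform A hA => ?_)
    all_goals
      obtain ⟨a, b, z, rfl⟩ := hsurj A hA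
      rw [hφ, hform]
      ext i j
      simp only [Matrix.smul_apply, Matrix.mul_apply, Fin.sum_univ_two,
        Matrix.conjTranspose_apply, Matrix.transpose_apply]
      fin_cases i <;> fin_cases j <;> simp [toHerm, entry00, entry01, entry10, entry11]

/-- Hermitian matrices of rank one are real multiples of `v * vᴴ`. -/
theorem exists_eq_smul_vecMulVec {X : Mat2} (hX : X ∈ H2set) (hdet : X.det = 0) :
    ∃ (r : ℝ) (v : Fin 2 → ℂ), X = r • Matrix.vecMulVec v (star v) := by
  obtain ⟨⟨a, b, z⟩, hx⟩ := hermEquiv.surjective ⟨X, hX⟩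
  obtain rfl : toHerm (a, b, z) = X := congrArg Subtype.val hx
  rw [toHerm_det, detForm_self_eq_zero_iff] at hdet
  rcases eq_or_ne a 0 with rfl | ha
  · have hz : z = 0 := by simpa using hdet.symm
    subst hz
    refine ⟨b, ![0, 1], ?_⟩
    ext i j
    rw [Matrix.smul_apply, Matrix.vecMulVec_apply]
    fin_cases i <;> fin_cases j <;> simp [toHerm]
  · have haC : (a : ℂ) ≠ 0 := by exact_mod_cast ha
    have hdetC : (a : ℂ) * b = (starRingEnd ℂ) z * z := by
      rw [mul_comm _ z, Complex.mul_conj, Complex.normSq_eq_norm_sq, ← hdet]; push_cast; rfl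
    refine ⟨a, ![1, (starRingEnd ℂ) z / a], ?_⟩
    ext i j
    rw [Matrix.smul_apply, Matrix.vecMulVec_apply]
    fin_cases i <;> fin_cases j <;> simp [toHerm] <;> field_simp
    rw [mul_comm, hdetC]

/-- Two singular hermitian matrices with nonsingular difference are simultaneously congruent to
diagonal ones. -/
theorem exists_congruence_diagonal {X Y : Mat2} (hX : X ∈ H2set) (hY : Y ∈ H2set)
    (hXd : X.det = 0) (hYd : Y.det = 0) (hXY : (X - Y).det ≠ 0) :
    ∃ (S : Mat2) (p q : ℝ), IsUnit S ∧ X = S * toHerm (p, 0, 0) * Sᴴ ∧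
      Y = S * toHerm (0, q, 0) * Sᴴ := by
  obtain ⟨p, v, rfl⟩ := exists_eq_smul_vecMulVec hX hXd
  obtain ⟨q, w, rfl⟩ := exists_eq_smul_vecMulVec hY hYd
  have e1 : p • Matrix.vecMulVec v (star v) =
      !![v 0, w 0; v 1, w 1] * toHerm (p, 0, 0) * (!![v 0, w 0; v 1, w 1])ᴴ := by
    ext i j
    fin_cases i <;> fin_cases j <;> simp [toHerm, Matrix.vecMulVec_apply, Matrix.mul_apply,
      Fin.sum_univ_two, Matrix.conjTranspose_apply] <;> ring
  have e2 : q • Matrix.vecMulVec w (star w) =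
      !![v 0, w 0; v 1, w 1] * toHerm (0, q, 0) * (!![v 0, w 0; v 1, w 1])ᴴ := by
    ext i j
    fin_cases i <;> fin_cases j <;> simp [toHerm, Matrix.vecMulVec_apply, Matrix.mul_apply,
      Fin.sum_univ_two, Matrix.conjTranspose_apply] <;> ring
  refine ⟨_, p, q, ?_, e1, e2⟩
  rw [e1, e2, ← Matrix.sub_mul, ← Matrix.mul_sub, Matrix.det_mul, Matrix.det_mul] at hXY
  rw [Matrix.isUnit_iff_isUnit_det, isUnit_iff_ne_zero]
  exact left_ne_zero_of_mul (left_ne_zero_of_mul hXY)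

end Hermitian

/-- A bijection of `H₂` preserving coherency in both directions is of the form
`A ↦ ±SAS* + T` or `A ↦ ±SAᵗS* + T` with `S` invertible and `T` hermitian. -/
theorem bijective_coherency_preserver_H2
    (φ : Mat2 → Mat2) (hbij : Set.BijOn φ H2set H2set)
    (h : ∀ A ∈ H2set, ∀ B ∈ H2set, ((A - B).rank ≤ 1 ↔ (φ A - φ B).rank ≤ 1)) :
    ∃ (c : ℝ) (S T : Mat2), (c = 1 ∨ c = -1) ∧ IsUnit S ∧ T.IsHermitian ∧
      ((∀ A ∈ H2set, φ A = c • (S * A * Sᴴ) + T) ∨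
       (∀ A ∈ H2set, φ A = c • (S * Aᵀ * Sᴴ) + T)) := by
  simp only [Matrix.rank_le_one_iff_det_eq_zero] at h
  have hT : φ (toHerm 0) ∈ H2set := hbij.mapsTo (toHerm_mem 0)
  have hdiff : ∀ x, φ (toHerm x) - φ (toHerm 0) ∈ H2set := fun x =>
    Matrix.IsHermitian.sub (hbij.mapsTo (toHerm_mem x)) hT
  have hsing : ∀ x, detForm x x = 0 → (φ (toHerm x) - φ (toHerm 0)).det = 0 := fun x hx =>
    (h _ (toHerm_mem x) _ (toHerm_mem 0)).1 (by rwa [toHerm_sub, sub_zero, toHerm_det])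
  obtain ⟨S, p, q, hS, h1, h2⟩ := exists_congruence_diagonal (hdiff (1, 0, 0)) (hdiff (0, 1, 0))
    (hsing _ (by simp [detForm_apply])) (hsing _ (by simp [detForm_apply])) (by
      rw [sub_sub_sub_cancel_right, Ne, ← h _ (toHerm_mem _) _ (toHerm_mem _), toHerm_sub,
        toHerm_det, detForm_apply]
      simp)
  have hSdet : IsUnit S.det := (Matrix.isUnit_iff_isUnit_det S).1 hS
  have hSi : S⁻¹ * S = 1 := Matrix.nonsing_inv_mul S hSdet
  have hSi' : S * S⁻¹ = 1 := Matrix.mul_nonsing_inv S hSdet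
  have hSh : Sᴴ * S⁻¹ᴴ = 1 := by rw [← Matrix.conjTranspose_mul, hSi, Matrix.conjTranspose_one]
  have hSh' : S⁻¹ᴴ * Sᴴ = 1 := by rw [← Matrix.conjTranspose_mul, hSi', Matrix.conjTranspose_one]
  have cancel : ∀ M, S⁻¹ * (S * M * Sᴴ) * S⁻¹ᴴ = M := fun M => by
    rw [Matrix.mul_assoc S, ← Matrix.mul_assoc S⁻¹ S, hSi, Matrix.one_mul, Matrix.mul_assoc, hSh,
      Matrix.mul_one]
  have cancel' : ∀ M, S * (S⁻¹ * M * S⁻¹ᴴ) * Sᴴ = M := fun M => by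
    rw [Matrix.mul_assoc S⁻¹, ← Matrix.mul_assoc S S⁻¹, hSi', Matrix.one_mul, Matrix.mul_assoc,
      hSh', Matrix.mul_one]
  have hbij' : Set.BijOn (fun A => S⁻¹ * (φ A - φ (toHerm 0)) * S⁻¹ᴴ) H2set H2set := by
    refine ⟨fun A hA => ?_, fun A hA B hB hAB => ?_, fun A hA => ?_⟩
    · exact Matrix.isHermitian_mul_mul_conjTranspose _
        (Matrix.IsHermitian.sub (hbij.mapsTo hA) hT)
    · have := congrArg (fun M => S * M * Sᴴ) hAB
      simp only [cancel', sub_left_inj] at this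
      exact hbij.injOn hA hB this
    · obtain ⟨B, hB, hBA⟩ := hbij.surjOn (Matrix.IsHermitian.add
        (Matrix.isHermitian_mul_mul_conjTranspose S hA) hT)
      refine ⟨B, hB, ?_⟩
      simp only [hBA, add_sub_cancel_right, cancel]
  have h' : ∀ A ∈ H2set, ∀ B ∈ H2set, ((A - B).det = 0 ↔
      (S⁻¹ * (φ A - φ (toHerm 0)) * S⁻¹ᴴ - S⁻¹ * (φ B - φ (toHerm 0)) * S⁻¹ᴴ).det = 0) := by
    intro A hA B hB
    rw [← Matrix.sub_mul, ← Matrix.mul_sub, sub_sub_sub_cancel_right, Matrix.det_mul,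
      Matrix.det_mul, Matrix.det_conjTranspose, h A hA B hB]
    simp [hSdet.ne_zero]
  obtain ⟨c, S', hc, hS', hform⟩ := coherency_preserver_normal_form hbij' h' (p := p) (q := q)
    (by ext i j; fin_cases i <;> fin_cases j <;> simp [toHerm])
    (by simp only [h1, cancel]) (by simp only [h2, cancel])
  refine ⟨c, S * S', φ (toHerm 0), hc, hS.mul hS', hT, ?_⟩
  refine hform.imp (fun hform A hA => ?_) (fun hform A hA => ?_)
  all_goals
    have := congrArg (fun M => S * M * Sᴴ) (hform A hA)
    simp only [cancel', sub_eq_iff_eq_add, Matrix.mul_smul, Matrix.smul_mul] at this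
    simp only [this, Matrix.conjTranspose_mul, Matrix.mul_assoc]
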